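/- For any hypergraph communication situation (N,v,H), any hyperlink e∈H and any player i∈e: Σ_{l∈U(H)(i,e)} Sh_l(U(H),w) = (1/|e|)·Sh_e(H,v^N). -/

import Mathlib

open scoped Classical
open Finset

noncomputable section

namespace HGGame

/-! ## Generic hypergraph notions -/

variable {α : Type*}

/-- Two nodes are linked if they lie in a common hyperlink of `E`. -/
def Linked (E : Finset (Finset α)) (a b : α) : Prop :=
  ∃ e ∈ E, a ∈ e ∧ b ∈ e

/-- The component of `i` in the subhypergraph of `(α, E)` induced by the ground set `S`
(only hyperlinks contained in `S` count). -/
def compOf (E : Finset (Finset α)) (S : Finset α) (i : α) : Finset α :=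
  S.filter (fun j => Relation.ReflTransGen (Linked (E.filter (fun e => e ⊆ S))) i j)

/-- The set `S/E` of components of the subhypergraph induced by `S`. -/
def components (E : Finset (Finset α)) (S : Finset α) : Finset (Finset α) :=
  S.image (compOf E S)

/-- The hypergraph-restricted worth `v^E(S) = Σ_{T ∈ S/E} v(T)`. -/
def restrictedWorth (v : Finset α → ℝ) (E : Finset (Finset α)) (S : Finset α) : ℝ :=
  ∑ T ∈ components E S, v T

/-! ## Shapley value -/

/-- The set `σ^i` of players preceding `i` in the ordering `σ`. -/
def preceding {M : Type*} [Fintype M] (σ : M ≃ Fin (Fintype.card M)) (i : M) : Finset M :=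
  Finset.univ.filter (fun j => σ j < σ i)

/-- The marginal contribution `m^σ_i(u) = u(σ^i ∪ {i}) - u(σ^i)`. -/
def marginal {M : Type*} [Fintype M] (u : Finset M → ℝ) (σ : M ≃ Fin (Fintype.card M))
    (i : M) : ℝ :=
  u (insert i (preceding σ i)) - u (preceding σ i)

/-- The Shapley value of the TU-game `(M, u)`. -/
def shapley {M : Type*} [Fintype M] (u : Finset M → ℝ) (i : M) : ℝ :=
  ((Fintype.card M).factorial : ℝ)⁻¹ * ∑ σ : M ≃ Fin (Fintype.card M), marginal u σ i

/-- The Harsanyi dividend `λ_T(u) = Σ_{∅ ≠ S ⊆ T} (-1)^{|T|-|S|} u(S)`. -/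
def dividend {M : Type*} (u : Finset M → ℝ) (T : Finset M) : ℝ :=
  ∑ S ∈ T.powerset.filter (fun S => S ≠ ∅), (-1 : ℝ) ^ (T.card - S.card) * u S

/-! ## Hypergraph communication situations -/

variable {N : Type*} [Fintype N] [DecidableEq N]

/-- The conference game `(H, v^N)`, a TU-game with player set `H`:
`v^N(H') = Σ_{T ∈ N/H'} v(T)`. -/
def confGame (v : Finset N → ℝ) (H : Finset (Finset N)) (F : Finset {e // e ∈ H}) : ℝ :=
  restrictedWorth v (F.image Subtype.val) Finset.univ

/-- The position value `π_i(N,v,H) = Σ_{e ∈ H_i} (1/|e|) · Sh_e(H, v^N)`. -/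
def positionValue (v : Finset N → ℝ) (H : Finset (Finset N)) (i : N) : ℝ :=
  ∑ e ∈ H.attach.filter (fun e => i ∈ e.val),
    ((e.val.card : ℝ))⁻¹ * shapley (confGame v H) e

/-! ## The uniform hyperlink game -/

/-- The type of agents `(i, e, k)` of the uniform hyperlink game. -/
abbrev UElem (N : Type*) := N × Finset N × ℕ

/-- `η(H)`: the least common multiple of the hyperlink sizes. -/
def eta (H : Finset (Finset N)) : ℕ := H.lcm Finset.card

/-- `U(H)(i,e) = {(i,e,k) : k = 1, …, η(H)/|e|}`. -/
def UHie (H : Finset (Finset N)) (i : N) (e : Finset N) : Finset (UElem N) :=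
  (Finset.Icc 1 (eta H / e.card)).image fun k => (i, e, k)

/-- `U(H)(i) = ∪_{e ∈ H_i} U(H)(i,e)`. -/
def UHi (H : Finset (Finset N)) (i : N) : Finset (UElem N) :=
  (H.filter (fun e => i ∈ e)).biUnion fun e => UHie H i e

/-- `U(H)(e) = ∪_{i ∈ e} U(H)(i,e)`. -/
def UHe (H : Finset (Finset N)) (e : Finset N) : Finset (UElem N) :=
  e.biUnion fun i => UHie H i e

/-- `U(H) = ∪_{i ∈ N} U(H)(i)`. -/
def UH (H : Finset (Finset N)) : Finset (UElem N) :=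
  Finset.univ.biUnion fun i : N => UHi H i

/-- `H[S] = {e ∈ H : U(H)(e) ⊆ S}`. -/
def Hof (H : Finset (Finset N)) (S : Finset (UElem N)) : Finset (Finset N) :=
  H.filter fun e => UHe H e ⊆ S

/-- The characteristic function `w(S) = Σ_{R ∈ N/H[S]} v(R)` of the uniform hyperlink game. -/
def uw (v : Finset N → ℝ) (H : Finset (Finset N)) (S : Finset (UElem N)) : ℝ :=
  restrictedWorth v (Hof H S) Finset.univ

/-- The uniform hyperlink game `(U(H), w)` as a TU-game with player set `U(H)`. -/
def uGame (v : Finset N → ℝ) (H : Finset (Finset N)) (F : Finset {l // l ∈ UH H}) : ℝ :=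
  uw v H (F.image Subtype.val)

/-! ## Shapley value of unanimity games -/

/-- The unanimity game of the coalition `T`. -/
def unanimity {M : Type*} (T S : Finset M) : ℝ := if T ⊆ S then 1 else 0

theorem exists_sum_unanimity {K : Type*} [Fintype K] (u : Finset K → ℝ) :
    ∃ c : Finset K → ℝ, u = fun S => ∑ T, c T * unanimity T S := by
  let c : Finset K → ℝ := fun T =>
    Finset.strongInduction (p := fun _ => ℝ)
      (fun T ih => u T - ∑ S ∈ T.ssubsets.attach, ih S.1 (Finset.mem_ssubsets.1 S.2)) T
  refine ⟨c, funext fun S => ?_⟩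
  have hc : c S = u S - ∑ T ∈ S.ssubsets, c T := by
    simp only [c]
    rw [Finset.strongInduction_eq, Finset.sum_attach S.ssubsets c]
  have hsum : ∑ T, c T * unanimity T S = ∑ T ∈ S.powerset, c T := by
    simp only [unanimity, mul_ite, mul_one, mul_zero]
    rw [← Finset.sum_filter]
    congr 1
    ext T
    simp
  rw [hsum, ← Finset.add_sum_erase S.powerset c (Finset.mem_powerset_self S), hc]
  simp [Finset.ssubsets]

theorem shapley_sum_mul {M ι : Type*} [Fintype M] [Fintype ι] (c : ι → ℝ)
    (g : ι → Finset M → ℝ) (i : M) :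
    shapley (fun S => ∑ t, c t * g t S) i = ∑ t, c t * shapley (g t) i := by
  simp only [shapley, marginal, ← Finset.sum_sub_distrib, ← mul_sub]
  rw [Finset.sum_comm, Finset.mul_sum]
  refine Finset.sum_congr rfl fun t _ => ?_
  rw [← Finset.mul_sum]
  ring

theorem marginal_unanimity_of_notMem {M : Type*} [Fintype M] {T : Finset M} {i : M}
    (hi : i ∉ T) (σ : M ≃ Fin (Fintype.card M)) : marginal (unanimity T) σ i = 0 := by
  simp [marginal, unanimity, Finset.subset_insert_iff_of_notMem hi]

theorem marginal_unanimity_of_mem {M : Type*} [Fintype M] {T : Finset M} {i : M}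
    (hi : i ∈ T) (σ : M ≃ Fin (Fintype.card M)) :
    marginal (unanimity T) σ i = if ∀ j ∈ T, σ j ≤ σ i then 1 else 0 := by
  have hnot : ¬ T ⊆ preceding σ i := fun h => by simpa [preceding] using h hi
  have hiff : T ⊆ insert i (preceding σ i) ↔ ∀ j ∈ T, σ j ≤ σ i := by
    simp only [Finset.subset_iff, preceding, Finset.mem_insert, Finset.mem_filter,
      Finset.mem_univ, true_and]
    refine forall₂_congr fun j _ => ?_
    rw [le_iff_eq_or_lt, σ.injective.eq_iff]
  simp only [marginal, unanimity, hnot, hiff, if_false, sub_zero]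

theorem sum_marginal_unanimity {M : Type*} [Fintype M] {T : Finset M} (hT : T.Nonempty)
    (σ : M ≃ Fin (Fintype.card M)) : ∑ i ∈ T, marginal (unanimity T) σ i = 1 := by
  obtain ⟨m, hm, hmax⟩ := T.exists_max_image σ hT
  rw [Finset.sum_eq_single_of_mem m hm, marginal_unanimity_of_mem hm, if_pos hmax]
  intro j hj hjm
  rw [marginal_unanimity_of_mem hj, if_neg]
  exact fun h => hjm (σ.injective (le_antisymm (hmax j hj) (h m hm)))

theorem shapley_unanimity_eq_of_mem {M : Type*} [Fintype M] {T : Finset M} {i j : M}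
    (hi : i ∈ T) (hj : j ∈ T) : shapley (unanimity T) i = shapley (unanimity T) j := by
  unfold shapley
  congr 1
  rw [← Equiv.sum_comp (Equiv.equivCongr (Equiv.swap i j) (Equiv.refl _))]
  refine Finset.sum_congr rfl fun σ _ => ?_
  rw [marginal_unanimity_of_mem hi, marginal_unanimity_of_mem hj]
  have hswap : ∀ k ∈ T, Equiv.swap i j k ∈ T := fun k hk => by
    rw [Equiv.swap_apply_def]
    split_ifs <;> assumption
  refine if_congr ⟨fun h k hk => ?_, fun h k hk => ?_⟩ rfl rfl
  · simpa using h _ (hswap k hk)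
  · simpa using h _ (hswap k hk)

theorem shapley_unanimity {M : Type*} [Fintype M] (T : Finset M) (i : M) :
    shapley (unanimity T) i = if i ∈ T then (T.card : ℝ)⁻¹ else 0 := by
  split_ifs with hi
  · have hsum : ∑ j ∈ T, shapley (unanimity T) j = 1 := by
      simp only [shapley]
      rw [← Finset.mul_sum, Finset.sum_comm,
        Finset.sum_congr rfl fun σ _ => sum_marginal_unanimity ⟨i, hi⟩ σ]
      simp [Fintype.card_equiv (Fintype.equivFin M), Nat.factorial_ne_zero]
    rw [Finset.sum_congr rfl fun j hj => shapley_unanimity_eq_of_mem hj hi,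
      Finset.sum_const, nsmul_eq_mul] at hsum
    exact eq_inv_of_mul_eq_one_right hsum
  · simp [shapley, marginal_unanimity_of_notMem hi]

/-! ## Splitting every player into equally many agents -/

/-- If every player of `(K, u)` is replaced by a group of `η` agents and a player is active exactly
when all its agents are, then each agent gets the share `1 / η` of its player's Shapley value. -/
theorem shapley_of_uniform_fibers {M K : Type*} [Fintype M] [Fintype K] (p : M → K) (η : ℕ)
    (hp : ∀ k, (Finset.univ.filter fun m => p m = k).card = η)
    (u : Finset K → ℝ) (w : Finset M → ℝ)
    (hw : ∀ S, w S = u (Finset.univ.filter fun k => ∀ m, p m = k → m ∈ S)) (l : M) :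
    shapley w l = (η : ℝ)⁻¹ * shapley u (p l) := by
  obtain ⟨c, rfl⟩ := exists_sum_unanimity u
  have hw' : w = fun S => ∑ T, c T * unanimity (Finset.univ.filter fun m => p m ∈ T) S := by
    funext S
    rw [hw]
    refine Finset.sum_congr rfl fun T _ => ?_
    congr 1
    refine if_congr ?_ rfl rfl
    simp only [Finset.subset_iff, Finset.mem_filter, Finset.mem_univ, true_and]
    exact ⟨fun h m hm => h hm m rfl, fun h k hk m hm => h (hm ▸ hk)⟩
  rw [hw', shapley_sum_mul, shapley_sum_mul, Finset.mul_sum]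
  refine Finset.sum_congr rfl fun T _ => ?_
  have hcard : (Finset.univ.filter fun m => p m ∈ T).card = T.card * η := by
    rw [Finset.card_eq_sum_card_fiberwise (f := p) (t := T) (fun m hm => by simpa using hm)]
    rw [← smul_eq_mul, ← Finset.sum_const]
    refine Finset.sum_congr rfl fun k hk => ?_
    rw [← hp k, Finset.filter_filter]
    congr 1
    ext m
    simp only [Finset.mem_filter, Finset.mem_univ, true_and, and_iff_right_iff_imp]
    rintro rfl
    exact hk
  rw [shapley_unanimity, shapley_unanimity, hcard]
  simp only [Finset.mem_filter, Finset.mem_univ, true_and]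
  split_ifs
  · push_cast
    rw [mul_inv]
    ring
  · simp

/-! ## Cardinalities in the uniform hyperlink game -/

theorem mem_UHie {N : Type*} [DecidableEq N] {H : Finset (Finset N)} {i : N}
    {e : Finset N} {l : UElem N} :
    l ∈ UHie H i e ↔ l.1 = i ∧ l.2.1 = e ∧ l.2.2 ∈ Finset.Icc 1 (eta H / e.card) := by
  obtain ⟨a, b, k⟩ := l
  simp only [UHie, Finset.mem_image, Prod.mk.injEq]
  constructor
  · rintro ⟨k, hk, rfl, rfl, rfl⟩
    exact ⟨rfl, rfl, hk⟩
  · rintro ⟨rfl, rfl, hk⟩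
    exact ⟨k, hk, rfl, rfl, rfl⟩

theorem mem_UHe {N : Type*} [DecidableEq N] {H : Finset (Finset N)} {e : Finset N} {l : UElem N} :
    l ∈ UHe H e ↔ l.1 ∈ e ∧ l.2.1 = e ∧ l.2.2 ∈ Finset.Icc 1 (eta H / e.card) := by
  simp only [UHe, Finset.mem_biUnion, mem_UHie]
  constructor
  · rintro ⟨i, hi, rfl, h⟩
    exact ⟨hi, h⟩
  · rintro ⟨hi, h⟩
    exact ⟨_, hi, rfl, h⟩

theorem mem_UH {H : Finset (Finset N)} {l : UElem N} :
    l ∈ UH H ↔ l.2.1 ∈ H ∧ l ∈ UHe H l.2.1 := by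
  simp only [UH, UHi, Finset.mem_biUnion, Finset.mem_filter, Finset.mem_univ, true_and,
    mem_UHie, mem_UHe]
  constructor
  · rintro ⟨i, e, ⟨he, hi⟩, rfl, rfl, h⟩
    exact ⟨he, hi, h⟩
  · rintro ⟨he, hi, h⟩
    exact ⟨_, _, ⟨he, hi⟩, rfl, rfl, h⟩

theorem UHe_subset_UH {H : Finset (Finset N)} {e : Finset N} (he : e ∈ H) :
    UHe H e ⊆ UH H := fun l hl => by
  obtain rfl := (mem_UHe.1 hl).2.1
  exact mem_UH.2 ⟨he, hl⟩

theorem card_UHie {N : Type*} [DecidableEq N] (H : Finset (Finset N)) (i : N) (e : Finset N) :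
    (UHie H i e).card = eta H / e.card := by
  rw [UHie, Finset.card_image_of_injective _ fun a b h => by simpa using h]
  simp

theorem card_UHe {N : Type*} [DecidableEq N] {H : Finset (Finset N)} {e : Finset N} (he : e ∈ H) :
    (UHe H e).card = eta H := by
  rw [UHe, Finset.card_biUnion]
  · simp only [card_UHie, Finset.sum_const, smul_eq_mul]
    exact Nat.mul_div_cancel' (Finset.dvd_lcm he)
  · intro i _ j _ hij
    exact Finset.disjoint_left.2 fun l hi hj => hij ((mem_UHie.1 hi).1.symm.trans (mem_UHie.1 hj).1)

theorem card_filter_subtype_mem {β : Type*} {A B : Finset β} (h : B ⊆ A)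
    [DecidablePred fun l : {l // l ∈ A} => l.val ∈ B] :
    (A.attach.filter fun l => l.val ∈ B).card = B.card := by
  rw [← Finset.card_map (Function.Embedding.subtype _)]
  congr 1
  ext l
  simpa using fun hl => h hl

/-- The hyperlink to which an agent of the uniform hyperlink game belongs. -/
def hyperlinkOf (H : Finset (Finset N)) (l : {l // l ∈ UH H}) : {e // e ∈ H} :=
  ⟨l.val.2.1, (mem_UH.1 l.property).1⟩

theorem hyperlinkOf_eq_iff {H : Finset (Finset N)} {l : {l // l ∈ UH H}} {e : {e // e ∈ H}} :
    hyperlinkOf H l = e ↔ l.val ∈ UHe H e.val := by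
  rw [Subtype.ext_iff]
  refine ⟨fun h => ?_, fun h => (mem_UHe.1 h).2.1⟩
  rw [← h]
  exact (mem_UH.1 l.property).2

theorem uGame_eq_confGame (v : Finset N → ℝ) (H : Finset (Finset N))
    (S : Finset {l // l ∈ UH H}) :
    uGame v H S =
      confGame v H (Finset.univ.filter fun e => ∀ l, hyperlinkOf H l = e → l ∈ S) := by
  unfold uGame uw confGame
  congr 1
  ext e
  simp only [Hof, Finset.mem_filter, Finset.mem_image, Finset.mem_univ, true_and,
    hyperlinkOf_eq_iff, Finset.subset_iff, Subtype.exists, exists_and_right, exists_eq_right]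
  constructor
  · rintro ⟨he, h⟩
    refine ⟨he, fun l hl => ?_⟩
    obtain ⟨_, hS⟩ := h hl
    exact hS
  · rintro ⟨he, h⟩
    exact ⟨he, fun l hl => ⟨UHe_subset_UH he hl, h _ hl⟩⟩

theorem shapley_uGame (v : Finset N → ℝ) (H : Finset (Finset N)) (l : {l // l ∈ UH H}) :
    shapley (uGame v H) l
      = (eta H : ℝ)⁻¹ * shapley (confGame v H) (hyperlinkOf H l) := by
  refine shapley_of_uniform_fibers (hyperlinkOf H) (eta H) (fun e => ?_) (confGame v H)
    (uGame v H) (fun S => ?_) l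
  · simp only [hyperlinkOf_eq_iff]
    rw [← card_UHe e.property, Finset.univ_eq_attach]
    exact card_filter_subtype_mem (UHe_subset_UH e.property)
  · rw [uGame_eq_confGame]
    congr!

/-- The Shapley payoffs of the uniform hyperlink game aggregate, over `U(H)(i,e)`,
to `(1/|e|)·Sh_e(H, v^N)`. -/
theorem uniform_hyperlink_shapley_aggregates_ie
    {N : Type*} [Fintype N] [DecidableEq N]
    (v : Finset N → ℝ) (H : Finset (Finset N))
    (hN : 2 ≤ Fintype.card N)
    (hv0 : v ∅ = 0) (hzn : ∀ i : N, v {i} = 0)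
    (hH : ∀ e ∈ H, 1 < e.card)
    (e : Finset N) (he : e ∈ H) (i : N) (hie : i ∈ e) :
    ∑ l ∈ (UH H).attach.filter (fun l => l.val ∈ UHie H i e),
        shapley (uGame v H) l
      = (e.card : ℝ)⁻¹ * shapley (confGame v H) ⟨e, he⟩ := by
  have hsub : UHie H i e ⊆ UHe H e := Finset.subset_biUnion_of_mem (UHie H · e) hie
  have heta : (eta H : ℝ) ≠ 0 := by
    rw [Nat.cast_ne_zero, eta, Ne, Finset.lcm_eq_zero_iff]
    rintro ⟨f, hf, h0⟩
    have := hH f hf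
    omega
  have hecard : (e.card : ℝ) ≠ 0 := Nat.cast_ne_zero.2 (by have := hH e he; omega)
  have hterm : ∀ l ∈ (UH H).attach.filter (fun l => l.val ∈ UHie H i e),
      shapley (uGame v H) l = (eta H : ℝ)⁻¹ * shapley (confGame v H) ⟨e, he⟩ := by
    intro l hl
    rw [shapley_uGame, (hyperlinkOf_eq_iff (e := ⟨e, he⟩)).2 (hsub (Finset.mem_filter.1 hl).2)]
  have hcard : ((UH H).attach.filter (fun l => l.val ∈ UHie H i e)).card
      = eta H / e.card := by
    rw [← card_UHie H i e]
    exact card_filter_subtype_mem (hsub.trans (UHe_subset_UH he))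
  rw [Finset.sum_congr rfl hterm, Finset.sum_const, hcard, nsmul_eq_mul,
    Nat.cast_div (show e.card ∣ eta H from Finset.dvd_lcm he) hecard]
  field_simp

end HGGame
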